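/- Let G be a finite group, k a field, K an algebraic closure of k, and M a finite-dimensional kG-module. If the trivial KG-module K is a direct summand of the KG-module K ⊗_k M, then the trivial kG-module k is a direct summand of M. -/

import Mathlib

open TensorProduct

section Defs

variable {k G : Type} [Field k] [Group G]

/-- A `kG`-linear map between two representations of `G` over `k`:
a `k`-linear map commuting with the `G`-actions. -/
def Equivariant {V W : Type} [AddCommGroup V] [Module k V] [AddCommGroup W] [Module k W]
    (ρV : Representation k G V) (ρW : Representation k G W) (f : V →ₗ[k] W) : Prop :=
  ∀ g : G, f ∘ₗ ρV g = ρW g ∘ₗ f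

/-- `ρU` is (isomorphic to) a direct summand of `ρM`, witnessed by an equivariant
split monomorphism. -/
def IsDirectSummandRep {U M : Type} [AddCommGroup U] [Module k U]
    [AddCommGroup M] [Module k M]
    (ρU : Representation k G U) (ρM : Representation k G M) : Prop :=
  ∃ (i : U →ₗ[k] M) (r : M →ₗ[k] U),
    Equivariant ρU ρM i ∧ Equivariant ρM ρU r ∧ r ∘ₗ i = LinearMap.id

/-- The base change (extension of scalars) of a representation along a field
extension `k → K`. -/
noncomputable def bcRep (K : Type) [Field K] [Algebra k K] {V : Type} [AddCommGroup V]
    [Module k V] (ρ : Representation k G V) : Representation K G (K ⊗[k] V) :=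
  (Module.End.baseChangeHom k K V).toRingHom.toMonoidHom.comp ρ

end Defs

/-- The coordinates of an invariant vector of `K ⊗ V`, relative to a `k`-basis of `K`, are
invariant vectors of `V`. -/
theorem equivFinsuppOfBasisLeft_invariant {k G K V ι : Type} [Field k] [Group G] [Field K]
    [Algebra k K] [AddCommGroup V] [Module k V] [DecidableEq ι] (ρ : Representation k G V)
    (B : Module.Basis ι k K) {x : K ⊗[k] V} (hx : ∀ g, bcRep K ρ g x = x) (g : G) (j : ι) :
    ρ g (TensorProduct.equivFinsuppOfBasisLeft B x j) =
      TensorProduct.equivFinsuppOfBasisLeft B x j := by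
  have comm : ∀ y : K ⊗[k] V, TensorProduct.equivFinsuppOfBasisLeft B (bcRep K ρ g y) j =
      ρ g (TensorProduct.equivFinsuppOfBasisLeft B y j) := fun y => by
    induction y with
    | zero => simp
    | add y z hy hz => simp only [map_add, Finsupp.add_apply, hy, hz]
    | tmul a m =>
      have : bcRep K ρ g (a ⊗ₜ[k] m) = a ⊗ₜ[k] ρ g m := rfl
      simp [this]
  rw [← comm, hx]

/-- If the trivial `KG`-module `K` is a direct summand of `K ⊗ₖ M` for an algebraic
closure `K` of `k`, then the trivial `kG`-module `k` is a direct summand of `M`. -/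
theorem trivial_summand_descends_from_algebraic_closure
    (k : Type) [Field k] (G : Type) [Group G] [Finite G]
    (K : Type) [Field K] [Algebra k K] [IsAlgClosure k K]
    (M : Type) [AddCommGroup M] [Module k M] [FiniteDimensional k M]
    (ρ : Representation k G M)
    (h : IsDirectSummandRep (Representation.trivial K (G := G) (V := K)) (bcRep K ρ)) :
    IsDirectSummandRep (Representation.trivial k (G := G) (V := k)) ρ := by
  classical
  obtain ⟨i, r, hi, hr, hri⟩ := h
  have hx : ∀ g, bcRep K ρ g (i 1) = i 1 := fun g => (LinearMap.congr_fun (hi g) 1).symm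
  have hrx : r (i 1) = 1 := LinearMap.congr_fun hri 1
  let B := Module.Basis.ofVectorSpace k K
  let e := TensorProduct.equivFinsuppOfBasisLeft (N := M) B
  obtain ⟨j, hj⟩ : ∃ j, r (1 ⊗ₜ[k] e (i 1) j) ≠ 0 := by
    by_contra! hzero
    have hsum : i 1 = (e (i 1)).sum fun j m => B j ⊗ₜ[k] m := by
      rw [← TensorProduct.equivFinsuppOfBasisLeft_symm_apply B (e (i 1))]
      exact (e.symm_apply_apply _).symm
    have : r (i 1) = 0 := by
      rw [hsum, Finsupp.sum, map_sum]
      refine Finset.sum_eq_zero fun j _ => ?_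
      have hs : B j ⊗ₜ[k] e (i 1) j = B j • ((1 : K) ⊗ₜ[k] e (i 1) j) := by
        rw [TensorProduct.smul_tmul', smul_eq_mul, mul_one]
      rw [hs, map_smul, hzero, smul_zero]
    exact one_ne_zero (hrx.symm.trans this)
  obtain ⟨f, hf⟩ := Module.Projective.exists_dual_eq_one k hj
  refine ⟨LinearMap.toSpanSingleton k M (e (i 1) j),
    f ∘ₗ r.restrictScalars k ∘ₗ TensorProduct.mk k K M 1, fun g => ?_, fun g => ?_, ?_⟩
  · ext
    simpa using (equivFinsuppOfBasisLeft_invariant ρ B hx g j).symm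
  · ext m
    exact congrArg f (LinearMap.congr_fun (hr g) (1 ⊗ₜ[k] m))
  · ext
    simpa using hf
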